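/- The Fourier transform maps the vector space of nice functions on ℝⁿ onto itself: for every nice function g : ℝⁿ → ℂ there exists a nice function f : ℝⁿ → ℂ with f̂ = g. -/

import Mathlib

open MeasureTheory Real
open scoped RealInnerProductSpace

noncomputable section

/-- The Fourier transform of `f : ℝⁿ → ℂ`:
`f̂ ξ = ∫ x, f x · exp (−2πi x·ξ)`. -/
def FT {n : ℕ} (f : EuclideanSpace ℝ (Fin n) → ℂ) (ξ : EuclideanSpace ℝ (Fin n)) : ℂ :=
  ∫ x : EuclideanSpace ℝ (Fin n),
    f x * Complex.exp (-2 * (Real.pi : ℂ) * Complex.I * (⟪x, ξ⟫ : ℂ))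

/-- `A : ℝⁿ → ℝⁿ` linear is symmetric and positive-definite. -/
def IsPosDefSymm {n : ℕ}
    (A : EuclideanSpace ℝ (Fin n) →ₗ[ℝ] EuclideanSpace ℝ (Fin n)) : Prop :=
  (∀ x y, ⟪A x, y⟫ = ⟪x, A y⟫) ∧ (∀ x, x ≠ 0 → 0 < ⟪A x, x⟫)

/-- The building block `x ↦ x^α · exp (−⟨A x, x⟩ + b·x)`. -/
def buildingBlock {n : ℕ} (α : Fin n → ℕ)
    (A : EuclideanSpace ℝ (Fin n) →ₗ[ℝ] EuclideanSpace ℝ (Fin n)) (b : Fin n → ℂ) :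
    EuclideanSpace ℝ (Fin n) → ℂ :=
  fun x => (∏ j, (x j : ℂ) ^ α j) *
    Complex.exp (-(((⟪A x, x⟫ : ℝ)) : ℂ) + ∑ j, b j * (x j : ℂ))

/-- A function `f : ℝⁿ → ℂ` is nice if it is a complex linear combination of
building blocks `x ↦ x^α · exp (−⟨A x, x⟩ + b·x)` with `A` positive-definite
symmetric. -/
def IsNice {n : ℕ} (f : EuclideanSpace ℝ (Fin n) → ℂ) : Prop :=
  f ∈ Submodule.span ℂ {g : EuclideanSpace ℝ (Fin n) → ℂ |
    ∃ α A b, IsPosDefSymm A ∧ g = buildingBlock α A b}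

/-- The partial derivative in the `j`-th coordinate direction. -/
def pderivCoord {n : ℕ} (j : Fin n) (f : EuclideanSpace ℝ (Fin n) → ℂ) :
    EuclideanSpace ℝ (Fin n) → ℂ :=
  fun x => fderiv ℝ f x (EuclideanSpace.single j 1)

/-- The mixed partial derivative `∂^{δ(α)}/∂x^α`, with `α j` derivatives in
the `j`-th coordinate direction. -/
def mixedDeriv {n : ℕ} (α : Fin n → ℕ) (f : EuclideanSpace ℝ (Fin n) → ℂ) :
    EuclideanSpace ℝ (Fin n) → ℂ :=
  (List.finRange n).foldr (fun j g => (pderivCoord j)^[α j] g) f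


/-- The inverse Fourier transform `φ̌ x = ∫ ξ, φ ξ · exp (2πi ξ·x)`. -/
def invFT {n : ℕ} (φ : EuclideanSpace ℝ (Fin n) → ℂ) (x : EuclideanSpace ℝ (Fin n)) : ℂ :=
  ∫ ξ : EuclideanSpace ℝ (Fin n),
    φ ξ * Complex.exp (2 * (Real.pi : ℂ) * Complex.I * (⟪ξ, x⟫ : ℂ))

end

/-- Multiplication by the `j`-th coordinate. -/
def coordMul {n : ℕ} (j : Fin n) (f : EuclideanSpace ℝ (Fin n) → ℂ) :
    EuclideanSpace ℝ (Fin n) → ℂ :=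
  fun x => (x j : ℂ) * f x

section Coordinates

variable {n : ℕ} (v : OrthonormalBasis (Fin n) ℝ (EuclideanSpace ℝ (Fin n)))

lemma OrthonormalBasis.sum_mul_repr_eq (e : Fin n → ℂ) (x : EuclideanSpace ℝ (Fin n)) :
    ∑ i, e i * (v.repr x i : ℂ) = ∑ j, (∑ i, e i * (v i j : ℂ)) * (x j : ℂ) := by
  have h (i : Fin n) : v.repr x i = ∑ j, v i j * x j := by
    rw [v.repr_apply_apply, PiLp.inner_apply]
    simp [mul_comm]
  simp_rw [h, Finset.sum_mul]
  rw [Finset.sum_comm]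
  simp [Finset.mul_sum, mul_assoc]

lemma OrthonormalBasis.sum_mul_coord_eq (b : Fin n → ℂ) (x : EuclideanSpace ℝ (Fin n)) :
    ∑ j, b j * (x j : ℂ) = ∑ i, (∑ j, b j * (v i j : ℂ)) * (v.repr x i : ℂ) := by
  have h (j : Fin n) : x j = ∑ i, v.repr x i * v i j := by
    conv_lhs => rw [← v.sum_repr x]
    simp
  conv_lhs => simp only [h]
  simp_rw [Finset.sum_mul]
  rw [Finset.sum_comm]
  push_cast
  simp only [Finset.mul_sum]
  exact Finset.sum_congr rfl fun j _ => Finset.sum_congr rfl fun i _ => by ring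

lemma OrthonormalBasis.inner_eq_sum_repr (x y : EuclideanSpace ℝ (Fin n)) :
    ⟪x, y⟫ = ∑ i, v.repr x i * v.repr y i := by
  rw [← v.sum_inner_mul_inner x y]
  simp [v.repr_apply_apply, real_inner_comm]

lemma OrthonormalBasis.integrable_gaussian {a : Fin n → ℝ} (ha : ∀ i, 0 < a i) (c : Fin n → ℂ) :
    Integrable (fun x : EuclideanSpace ℝ (Fin n) =>
      Complex.exp (-∑ i, (a i : ℂ) * (v.repr x i : ℂ) ^ 2 + ∑ i, c i * (v.repr x i : ℂ))) := by
  have h := GaussianFourier.integrable_cexp_neg_sum_mul_add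
    (b := fun i => (a i : ℂ)) (fun i => by simpa using ha i) c
  have h2 := ((EuclideanSpace.volume_preserving_symm_measurableEquiv_toLp
    (Fin n)).comp v.measurePreserving_repr).integrable_comp_of_integrable h
  exact h2

lemma OrthonormalBasis.integral_gaussian {a : Fin n → ℝ} (ha : ∀ i, 0 < a i) (c : Fin n → ℂ) :
    ∫ x : EuclideanSpace ℝ (Fin n),
      Complex.exp (-∑ i, (a i : ℂ) * (v.repr x i : ℂ) ^ 2 + ∑ i, c i * (v.repr x i : ℂ)) =
    ∏ i, (π / (a i : ℂ)) ^ (1 / 2 : ℂ) * Complex.exp (c i ^ 2 / (4 * (a i : ℂ))) := by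
  rw [← GaussianFourier.integral_cexp_neg_sum_mul_add
    (b := fun i => (a i : ℂ)) (fun i => by simpa using ha i) c]
  have h := (EuclideanSpace.volume_preserving_symm_measurableEquiv_toLp
    (Fin n)).comp v.measurePreserving_repr
  exact h.integral_comp ((MeasurableEquiv.measurableEmbedding _).comp
    v.repr.toHomeomorph.measurableEmbedding)
      (fun y : Fin n → ℝ => Complex.exp (-∑ i, (a i : ℂ) * (y i : ℂ) ^ 2 + ∑ i, c i * (y i : ℂ)))

/-- The linear map with eigenvectors `v i` and eigenvalues `a i`. -/
noncomputable def OrthonormalBasis.diagonalMap (a : Fin n → ℝ) :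
    EuclideanSpace ℝ (Fin n) →ₗ[ℝ] EuclideanSpace ℝ (Fin n) :=
  ∑ i, a i • (innerₛₗ ℝ (v i)).smulRight (v i)

lemma OrthonormalBasis.inner_diagonalMap (a : Fin n → ℝ) (x y : EuclideanSpace ℝ (Fin n)) :
    ⟪v.diagonalMap a x, y⟫ = ∑ i, a i * (v.repr x i * v.repr y i) := by
  simp [OrthonormalBasis.diagonalMap, sum_inner, inner_smul_left, v.repr_apply_apply]

lemma OrthonormalBasis.isPosDefSymm_diagonalMap {a : Fin n → ℝ} (ha : ∀ i, 0 < a i) :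
    IsPosDefSymm (v.diagonalMap a) := by
  refine ⟨fun x y => ?_, fun x hx => ?_⟩
  · rw [real_inner_comm (v.diagonalMap a y), v.inner_diagonalMap, v.inner_diagonalMap]
    simp [mul_comm]
  · rw [v.inner_diagonalMap]
    obtain ⟨i, hi⟩ : ∃ i, v.repr x i ≠ 0 := by
      by_contra! h
      exact hx (v.repr.map_eq_zero_iff.1 (by ext i; simpa using h i))
    exact Finset.sum_pos' (fun i _ => mul_nonneg (ha i).le (mul_self_nonneg _))
      ⟨i, Finset.mem_univ i, mul_pos (ha i) (mul_self_pos.2 hi)⟩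

end Coordinates

section Nice

variable {n : ℕ}

lemma IsPosDefSymm.exists_diagonalization
    {A : EuclideanSpace ℝ (Fin n) →ₗ[ℝ] EuclideanSpace ℝ (Fin n)} (hA : IsPosDefSymm A) :
    ∃ (v : OrthonormalBasis (Fin n) ℝ (EuclideanSpace ℝ (Fin n))) (a : Fin n → ℝ),
      (∀ i, 0 < a i) ∧ ∀ x, ⟪A x, x⟫ = ∑ i, a i * v.repr x i ^ 2 := by
  have hs : A.IsSymmetric := hA.1
  have hn : Module.finrank ℝ (EuclideanSpace ℝ (Fin n)) = n := by simp
  refine ⟨hs.eigenvectorBasis hn, hs.eigenvalues hn, fun i => ?_, fun x => ?_⟩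
  · have h := hA.2 (hs.eigenvectorBasis hn i) ((hs.eigenvectorBasis hn).orthonormal.ne_zero i)
    rw [hs.apply_eigenvectorBasis, inner_smul_left, real_inner_self_eq_norm_sq] at h
    simpa using h
  · rw [(hs.eigenvectorBasis hn).inner_eq_sum_repr]
    simp only [hs.eigenvectorBasis_apply_self_apply]
    exact Finset.sum_congr rfl fun i _ => by simp; ring

lemma buildingBlock_zero_apply {A : EuclideanSpace ℝ (Fin n) →ₗ[ℝ] EuclideanSpace ℝ (Fin n)}
    {b : Fin n → ℂ} (x : EuclideanSpace ℝ (Fin n)) :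
    buildingBlock 0 A b x = Complex.exp (-((⟪A x, x⟫ : ℝ) : ℂ) + ∑ j, b j * (x j : ℂ)) := by
  simp [buildingBlock]

lemma coordMul_buildingBlock (j : Fin n) (α : Fin n → ℕ)
    (A : EuclideanSpace ℝ (Fin n) →ₗ[ℝ] EuclideanSpace ℝ (Fin n)) (b : Fin n → ℂ) :
    coordMul j (buildingBlock α A b) = buildingBlock (α + Pi.single j 1) A b := by
  ext x
  have h : ∏ i, (x i : ℂ) ^ (Pi.single j 1 : Fin n → ℕ) i = x j := by
    rw [Finset.prod_eq_single j] <;> simp +contextual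
  simp only [coordMul, buildingBlock, Pi.add_apply, pow_add, Finset.prod_mul_distrib, h]
  ring

lemma isNice_buildingBlock {α : Fin n → ℕ}
    {A : EuclideanSpace ℝ (Fin n) →ₗ[ℝ] EuclideanSpace ℝ (Fin n)} (hA : IsPosDefSymm A)
    (b : Fin n → ℂ) : IsNice (buildingBlock α A b) :=
  Submodule.subset_span ⟨α, A, b, hA, rfl⟩

lemma IsNice.add {f g : EuclideanSpace ℝ (Fin n) → ℂ} (hf : IsNice f) (hg : IsNice g) :
    IsNice (f + g) := Submodule.add_mem _ hf hg

lemma IsNice.smul {f : EuclideanSpace ℝ (Fin n) → ℂ} (c : ℂ) (hf : IsNice f) :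
    IsNice (c • f) := Submodule.smul_mem _ c hf

lemma isNice_zero : IsNice (0 : EuclideanSpace ℝ (Fin n) → ℂ) := Submodule.zero_mem _

lemma coordMul_add (j : Fin n) (f g : EuclideanSpace ℝ (Fin n) → ℂ) :
    coordMul j (f + g) = coordMul j f + coordMul j g := by
  ext x; simp [coordMul, mul_add]

lemma coordMul_smul (j : Fin n) (c : ℂ) (f : EuclideanSpace ℝ (Fin n) → ℂ) :
    coordMul j (c • f) = c • coordMul j f := by
  ext x; simp [coordMul]; ring

lemma IsNice.mul_coord (j : Fin n) {f : EuclideanSpace ℝ (Fin n) → ℂ} (hf : IsNice f) :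
    IsNice (coordMul j f) := by
  induction hf using Submodule.span_induction with
  | mem f h =>
    obtain ⟨α, A, b, hA, rfl⟩ := h
    rw [coordMul_buildingBlock]
    exact isNice_buildingBlock hA b
  | zero =>
    convert isNice_zero (n := n) using 1
    ext x; simp [coordMul]
  | add f g _ _ hf hg => rw [coordMul_add]; exact hf.add hg
  | smul c f _ hf => rw [coordMul_smul]; exact hf.smul c

/-- Nice functions are generated from Gaussians by linear combinations and multiplication by
coordinates. -/
lemma IsNice.induction {P : (f : EuclideanSpace ℝ (Fin n) → ℂ) → IsNice f → Prop}
    (gaussian : ∀ A b (hA : IsPosDefSymm A), P (buildingBlock 0 A b) (isNice_buildingBlock hA b))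
    (zero : P 0 isNice_zero)
    (add : ∀ f g (hf : IsNice f) (hg : IsNice g), P f hf → P g hg → P (f + g) (hf.add hg))
    (smul : ∀ (c : ℂ) f (hf : IsNice f), P f hf → P (c • f) (hf.smul c))
    (coord : ∀ j f (hf : IsNice f), P f hf → P (coordMul j f) (hf.mul_coord j))
    {f : EuclideanSpace ℝ (Fin n) → ℂ} (hf : IsNice f) : P f hf := by
  have block (A b) (hA : IsPosDefSymm A) (k : ℕ) :
      ∀ α : Fin n → ℕ, ∑ j, α j = k → P (buildingBlock α A b) (isNice_buildingBlock hA b) := by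
    induction k with
    | zero =>
      intro α h
      obtain rfl : α = 0 := by ext j; simpa using Finset.sum_eq_zero_iff.1 h j (Finset.mem_univ j)
      exact gaussian A b hA
    | succ k ih =>
      intro α h
      obtain ⟨j, -, hj⟩ : ∃ j ∈ Finset.univ, α j ≠ 0 :=
        Finset.exists_ne_zero_of_sum_ne_zero (by omega)
      obtain ⟨β, rfl⟩ : ∃ β : Fin n → ℕ, α = β + Pi.single j 1 := by
        refine ⟨α - Pi.single j 1, (tsub_add_cancel_of_le fun i => ?_).symm⟩
        by_cases hi : i = j
        · subst hi; simp; omega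
        · simp [hi]
      have := coord j _ (isNice_buildingBlock hA b)
        (ih β (by simpa [Finset.sum_add_distrib] using h))
      simpa only [coordMul_buildingBlock] using this
  induction hf using Submodule.span_induction with
  | mem f h => obtain ⟨α, A, b, hA, rfl⟩ := h; exact block A b hA _ α rfl
  | zero => exact zero
  | add f g hf hg ihf ihg => exact add f g hf hg ihf ihg
  | smul c f hf ih => exact smul c f hf ih

lemma IsNice.sum {ι : Type*} (s : Finset ι) {f : ι → EuclideanSpace ℝ (Fin n) → ℂ}
    (hf : ∀ i ∈ s, IsNice (f i)) : IsNice (∑ i ∈ s, f i) := Submodule.sum_mem _ hf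

lemma hasFDerivAt_coord (j : Fin n) (x : EuclideanSpace ℝ (Fin n)) :
    HasFDerivAt (fun x : EuclideanSpace ℝ (Fin n) => (x j : ℂ))
      (Complex.ofRealCLM.comp (EuclideanSpace.proj j)) x :=
  (Complex.ofRealCLM.comp (EuclideanSpace.proj j : EuclideanSpace ℝ (Fin n) →L[ℝ] ℝ)).hasFDerivAt

lemma differentiable_and_pderivCoord_gaussian
    {A : EuclideanSpace ℝ (Fin n) →ₗ[ℝ] EuclideanSpace ℝ (Fin n)} (hA : IsPosDefSymm A)
    (b : Fin n → ℂ) :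
    Differentiable ℝ (buildingBlock 0 A b) ∧ ∀ j, IsNice (pderivCoord j (buildingBlock 0 A b)) := by
  have hb (x : EuclideanSpace ℝ (Fin n)) :
      HasFDerivAt (fun x : EuclideanSpace ℝ (Fin n) => ∑ j, b j * (x j : ℂ))
        (∑ j, b j • (Complex.ofRealCLM.comp (EuclideanSpace.proj j))) x :=
    HasFDerivAt.fun_sum fun j _ => (hasFDerivAt_coord j x).const_mul (b j)
  have hq (x : EuclideanSpace ℝ (Fin n)) :=
    Complex.ofRealCLM.hasFDerivAt.comp x
      ((A.toContinuousLinearMap.hasFDerivAt (x := x)).inner ℝ (hasFDerivAt_id x))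
  have hd (x : EuclideanSpace ℝ (Fin n)) : HasFDerivAt (buildingBlock 0 A b)
      (buildingBlock 0 A b x • (-(Complex.ofRealCLM.comp ((fderivInnerCLM ℝ (A x, x)).comp
          (A.toContinuousLinearMap.prod (.id ℝ _)))) +
        ∑ j, b j • (Complex.ofRealCLM.comp (EuclideanSpace.proj j)))) x := by
    rw [show buildingBlock 0 A b = _ from funext buildingBlock_zero_apply]
    exact ((hq x).neg.add (hb x)).cexp
  refine ⟨fun x => (hd x).differentiableAt, fun j => ?_⟩
  have hj (x : EuclideanSpace ℝ (Fin n)) : ⟪x, A (EuclideanSpace.single j 1)⟫ =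
      ∑ k, A (EuclideanSpace.single j 1) k * x k := by
    rw [PiLp.inner_apply]
    simp
  have : pderivCoord j (buildingBlock 0 A b) =
      (∑ k, (-2 * (A (EuclideanSpace.single j 1) k : ℂ)) • coordMul k (buildingBlock 0 A b)) +
        b j • buildingBlock 0 A b := by
    ext x
    have hsum : ∑ k, b k * ((EuclideanSpace.single j 1 : EuclideanSpace ℝ (Fin n)) k : ℂ) =
        b j := by
      rw [Finset.sum_eq_single j] <;> simp +contextual
    rw [pderivCoord, (hd x).fderiv]
    simp only [smul_apply, add_apply,
      neg_apply, ContinuousLinearMap.comp_apply, fderivInnerCLM_apply,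
      ContinuousLinearMap.prod_apply, ContinuousLinearMap.id_apply,
      LinearMap.coe_toContinuousLinearMap', _root_.sum_apply,
      Complex.ofRealCLM_apply, PiLp.proj_apply, smul_eq_mul, hsum,
      Pi.add_apply, Finset.sum_apply, Pi.smul_apply, coordMul]
    rw [hA.1, real_inner_comm x, hj]
    push_cast
    simp only [mul_add, mul_neg, Finset.mul_sum, ← Finset.sum_neg_distrib,
      ← Finset.sum_add_distrib]
    rw [mul_comm (b j)]
    congr 1
    exact Finset.sum_congr rfl fun k _ => by ring
  rw [this]
  exact (IsNice.sum _ fun k _ => ((isNice_buildingBlock hA b).mul_coord k).smul _).add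
    ((isNice_buildingBlock hA b).smul _)

lemma IsNice.differentiable_and_pderivCoord {f : EuclideanSpace ℝ (Fin n) → ℂ} (hf : IsNice f) :
    Differentiable ℝ f ∧ ∀ j, IsNice (pderivCoord j f) := by
  induction hf using IsNice.induction with
  | gaussian A b hA => exact differentiable_and_pderivCoord_gaussian hA b
  | zero =>
    refine ⟨differentiable_const _, fun j => ?_⟩
    convert isNice_zero (n := n) using 1
    ext x; simp [pderivCoord]
  | add f g _ _ hf hg =>
    refine ⟨hf.1.add hg.1, fun j => ?_⟩
    convert (hf.2 j).add (hg.2 j) using 1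
    ext x; simp [pderivCoord, fderiv_add (hf.1 x) (hg.1 x)]
  | smul c f _ hf =>
    refine ⟨hf.1.const_smul c, fun j => ?_⟩
    convert (hf.2 j).smul c using 1
    ext x; simp [pderivCoord, fderiv_const_smul (hf.1 x) c]
  | coord k f hn hf =>
    have hd (x) := (hasFDerivAt_coord k x).mul (hf.1 x).hasFDerivAt
    refine ⟨fun x => (hd x).differentiableAt, fun j => ?_⟩
    convert ((hf.2 j).mul_coord k).add
      (hn.smul ((EuclideanSpace.single j 1 : EuclideanSpace ℝ (Fin n)) k : ℂ)) using 1
    ext x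
    have h1 : fderiv ℝ (coordMul k f) x = _ := (hd x).fderiv
    rw [pderivCoord, h1]
    by_cases h : k = j <;> simp [pderivCoord, coordMul, h]

lemma IsNice.integrable_mul_cexp {f : EuclideanSpace ℝ (Fin n) → ℂ} (hf : IsNice f) :
    ∀ b : Fin n → ℂ, Integrable (fun x => f x * Complex.exp (∑ j, b j * (x j : ℂ))) := by
  induction hf using IsNice.induction with
  | gaussian A d hA =>
    intro b
    obtain ⟨v, a, ha, hv⟩ := hA.exists_diagonalization
    refine (v.integrable_gaussian ha fun i => ∑ j, (d + b) j * (v i j : ℂ)).congr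
      (Filter.Eventually.of_forall fun x => ?_)
    dsimp only
    rw [buildingBlock_zero_apply, ← Complex.exp_add, hv, ← v.sum_mul_coord_eq]
    congr 1
    simp [add_mul, Finset.sum_add_distrib, add_assoc]
  | zero => simp
  | add f g _ _ hf hg =>
    intro b
    simp only [Pi.add_apply, add_mul]
    exact (hf b).add (hg b)
  | smul c f _ hf =>
    intro b
    simpa [mul_assoc] using (hf b).const_mul c
  | coord k f hn hf =>
    intro b
    have hc : Continuous f := hn.differentiable_and_pderivCoord.1.continuous
    have hs (c : ℂ) (x : EuclideanSpace ℝ (Fin n)) :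
        f x * Complex.exp (∑ j, (b + Pi.single k c : Fin n → ℂ) j * (x j : ℂ)) =
        f x * Complex.exp (∑ j, b j * (x j : ℂ)) * Complex.exp (c * x k) := by
      simp [add_mul, Finset.sum_add_distrib, Complex.exp_add, mul_assoc, Pi.single_apply]
    refine ((hf (b + Pi.single k 1)).norm.add (hf (b + Pi.single k (-1))).norm).mono' ?_ ?_
    · unfold coordMul
      exact Continuous.aestronglyMeasurable (by fun_prop)
    · refine Filter.Eventually.of_forall fun x => ?_
      rw [Pi.add_apply, hs, hs]
      simp only [norm_mul, coordMul, Complex.norm_real]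
      have h : ‖x k‖ ≤ ‖Complex.exp (1 * (x k : ℂ))‖ + ‖Complex.exp (-1 * (x k : ℂ))‖ := by
        simp only [Complex.norm_exp, Real.norm_eq_abs]
        simp
        have h1 := Real.add_one_le_exp (x k)
        have h2 := Real.add_one_le_exp (-x k)
        have h3 := Real.exp_pos (x k)
        have h4 := Real.exp_pos (-x k)
        exact abs_le.2 ⟨by linarith, by linarith⟩
      have := mul_le_mul_of_nonneg_right h
        (mul_nonneg (norm_nonneg (f x)) (norm_nonneg (Complex.exp (∑ j, b j * (x j : ℂ)))))
      linarith

lemma fourierKernel_eq (x ξ : EuclideanSpace ℝ (Fin n)) :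
    Complex.exp (-2 * (π : ℂ) * Complex.I * (⟪x, ξ⟫ : ℂ)) =
      Complex.exp (∑ j, (-2 * (π : ℂ) * Complex.I * ξ j) * (x j : ℂ)) := by
  rw [PiLp.inner_apply]
  simp [Finset.mul_sum, mul_assoc]

lemma IsNice.integrable_mul_fourierKernel {f : EuclideanSpace ℝ (Fin n) → ℂ} (hf : IsNice f)
    (ξ : EuclideanSpace ℝ (Fin n)) :
    Integrable (fun x => f x * Complex.exp (-2 * (π : ℂ) * Complex.I * (⟪x, ξ⟫ : ℂ))) := by
  simp_rw [fourierKernel_eq]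
  exact hf.integrable_mul_cexp _

lemma FT_smul (c : ℂ) (f : EuclideanSpace ℝ (Fin n) → ℂ) : FT (c • f) = c • FT f := by
  ext ξ
  simp [FT, mul_assoc, integral_const_mul]

lemma IsNice.FT_add {f g : EuclideanSpace ℝ (Fin n) → ℂ} (hf : IsNice f) (hg : IsNice g) :
    FT (f + g) = FT f + FT g := by
  ext ξ
  simp only [FT, Pi.add_apply, add_mul]
  exact integral_add (hf.integrable_mul_fourierKernel ξ) (hg.integrable_mul_fourierKernel ξ)

lemma IsNice.FT_pderivCoord {f : EuclideanSpace ℝ (Fin n) → ℂ} (hf : IsNice f) (j : Fin n) :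
    FT (pderivCoord j f) = (2 * (π : ℂ) * Complex.I) • coordMul j (FT f) := by
  ext ξ
  obtain ⟨hd, hp⟩ := hf.differentiable_and_pderivCoord
  have hk (x : EuclideanSpace ℝ (Fin n)) :=
    ((Complex.ofRealCLM.hasFDerivAt.comp x
      ((hasFDerivAt_id x).inner ℝ (hasFDerivAt_const ξ x))).const_mul
        (-2 * (π : ℂ) * Complex.I)).cexp
  have hk' (x : EuclideanSpace ℝ (Fin n)) :
      fderiv ℝ (fun x : EuclideanSpace ℝ (Fin n) =>
        Complex.exp (-2 * (π : ℂ) * Complex.I * (⟪x, ξ⟫ : ℂ))) x (EuclideanSpace.single j 1) =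
      (-2 * (π : ℂ) * Complex.I * ξ j) *
        Complex.exp (-2 * (π : ℂ) * Complex.I * (⟪x, ξ⟫ : ℂ)) := by
    have h1 : fderiv ℝ (fun x : EuclideanSpace ℝ (Fin n) =>
        Complex.exp (-2 * (π : ℂ) * Complex.I * (⟪x, ξ⟫ : ℂ))) x = _ := (hk x).fderiv
    rw [h1]
    simp [EuclideanSpace.inner_single_left]
    ring
  have hi := hf.integrable_mul_fourierKernel ξ
  have h := integral_mul_fderiv_eq_neg_fderiv_mul_of_integrable (μ := volume) (f := f)
    (g := fun x : EuclideanSpace ℝ (Fin n) =>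
      Complex.exp (-2 * (π : ℂ) * Complex.I * (⟪x, ξ⟫ : ℂ)))
    (v := EuclideanSpace.single j 1) ((hp j).integrable_mul_fourierKernel ξ)
    (by
      simp_rw [hk', mul_left_comm (f _)]
      exact hi.const_mul _)
    hi (fun x _ => hd x) (fun x _ => (hk x).differentiableAt)
  simp_rw [hk', mul_left_comm (f _)] at h
  rw [integral_const_mul, eq_neg_iff_add_eq_zero, add_comm, ← eq_neg_iff_add_eq_zero] at h
  refine h.trans ?_
  simp only [Pi.smul_apply, coordMul, smul_eq_mul, FT]
  ring

lemma exists_isNice_FT_eq_gaussian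
    {A : EuclideanSpace ℝ (Fin n) →ₗ[ℝ] EuclideanSpace ℝ (Fin n)} (hA : IsPosDefSymm A)
    (b : Fin n → ℂ) : ∃ f, IsNice f ∧ FT f = buildingBlock 0 A b := by
  obtain ⟨v, a, ha, hv⟩ := hA.exists_diagonalization
  set β : Fin n → ℂ := fun i => ∑ j, b j * (v i j : ℂ)
  set e : Fin n → ℂ := fun i => Complex.I * π * β i / a i with he
  set l : Fin n → ℝ := fun i => π ^ 2 / a i with hl
  have hlpos (i) : 0 < l i := div_pos (by positivity) (ha i)
  set K : ℂ := ∏ i, (π / (l i : ℂ)) ^ (1 / 2 : ℂ) * Complex.exp (e i ^ 2 / (4 * (l i : ℂ))) with hK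
  have hK0 : K ≠ 0 := by
    refine Finset.prod_ne_zero_iff.2 fun i _ => mul_ne_zero ?_ (Complex.exp_ne_zero _)
    refine (Complex.cpow_ne_zero_iff_of_exponent_ne_zero (by norm_num)).2 (div_ne_zero ?_ ?_)
    · exact_mod_cast Real.pi_ne_zero
    · exact_mod_cast (hlpos i).ne'
  refine ⟨K⁻¹ • buildingBlock 0 (v.diagonalMap l) (fun j => ∑ i, e i * (v i j : ℂ)),
    (isNice_buildingBlock (v.isPosDefSymm_diagonalMap hlpos) _).smul _, ?_⟩
  ext ξ
  rw [FT_smul, Pi.smul_apply, smul_eq_mul, inv_mul_eq_iff_eq_mul₀ hK0, FT]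
  have h1 (x : EuclideanSpace ℝ (Fin n)) :
      buildingBlock 0 (v.diagonalMap l) (fun j => ∑ i, e i * (v i j : ℂ)) x *
        Complex.exp (-2 * (π : ℂ) * Complex.I * (⟪x, ξ⟫ : ℂ)) =
      Complex.exp (-∑ i, (l i : ℂ) * (v.repr x i : ℂ) ^ 2 +
        ∑ i, (e i - 2 * π * Complex.I * v.repr ξ i) * (v.repr x i : ℂ)) := by
    rw [buildingBlock_zero_apply, ← Complex.exp_add, v.inner_diagonalMap, ← v.sum_mul_repr_eq,
      v.inner_eq_sum_repr]
    congr 1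
    push_cast
    simp only [Finset.mul_sum, ← sq, add_assoc, ← Finset.sum_add_distrib]
    congr 1
    exact Finset.sum_congr rfl fun i _ => by ring
  simp_rw [h1]
  rw [v.integral_gaussian hlpos, buildingBlock_zero_apply, hv, v.sum_mul_coord_eq, hK,
    Complex.ofReal_sum, ← Finset.sum_neg_distrib, ← Finset.sum_add_distrib, Complex.exp_sum,
    ← Finset.prod_mul_distrib]
  refine Finset.prod_congr rfl fun i _ => ?_
  rw [mul_assoc ((_ : ℂ) ^ (_ : ℂ)), ← Complex.exp_add]
  congr 2
  change _ = _ + (_ + β i * _)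
  have hai : (a i : ℂ) ≠ 0 := by exact_mod_cast (ha i).ne'
  have hpi : (π : ℂ) ≠ 0 := by exact_mod_cast Real.pi_ne_zero
  simp only [he, hl]
  push_cast
  field_simp
  ring_nf
  simp only [Complex.I_sq]
  ring

end Nice

/-- The Fourier transform maps nice functions onto nice functions. -/
theorem fourier_transform_surjective_on_nice (n : ℕ)
    (g : EuclideanSpace ℝ (Fin n) → ℂ) (hg : IsNice g) :
    ∃ f : EuclideanSpace ℝ (Fin n) → ℂ, IsNice f ∧ FT f = g := by
  induction hg using IsNice.induction with
  | gaussian A b hA => exact exists_isNice_FT_eq_gaussian hA b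
  | zero => exact ⟨0, isNice_zero, by ext ξ; simp [FT]⟩
  | add g₁ g₂ _ _ h₁ h₂ =>
    obtain ⟨f₁, hf₁, rfl⟩ := h₁
    obtain ⟨f₂, hf₂, rfl⟩ := h₂
    exact ⟨f₁ + f₂, hf₁.add hf₂, hf₁.FT_add hf₂⟩
  | smul c g _ h =>
    obtain ⟨f, hf, rfl⟩ := h
    exact ⟨c • f, hf.smul c, FT_smul c f⟩
  | coord j g _ h =>
    obtain ⟨f, hf, rfl⟩ := h
    have hpi : 2 * (π : ℂ) * Complex.I ≠ 0 := by simp [Real.pi_ne_zero]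
    exact ⟨(2 * (π : ℂ) * Complex.I)⁻¹ • pderivCoord j f,
      (hf.differentiable_and_pderivCoord.2 j).smul _,
      by rw [FT_smul, hf.FT_pderivCoord, inv_smul_smul₀ hpi]⟩
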